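/- arXiv:2504.03232 — 4 statements merged into one kernel-verified Lean document; each statement's English description precedes it below -/
import Mathlib

section
/- There exists a constant C > 0 such that for all 0 < σ ≤ 1 and all y₁, y₂ ∈ ℝ³, one has |−(Δ_{y₁} K_σ)(y₁,y₂) + |y₁|² · K_σ(y₁,y₂)| ≤ C · σ^{−5/2} · exp(−|y₁−y₂|²/(8·tanh σ)), where Δ_{y₁} denotes the Laplacian acting on the first variable. -/
open MeasureTheory Real

noncomputable section

/-- Mehler heat kernel of the harmonic oscillator `H = -Δ + |x|²` on `ℝ³`. -/
def mehlerK (t : ℝ) (x y : EuclideanSpace ℝ (Fin 3)) : ℝ :=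
  (2 * π * Real.sinh (2 * t)) ^ (-(3 : ℝ) / 2) *
    Real.exp (-‖x - y‖ ^ 2 / (4 * Real.tanh t) - Real.tanh t * ‖x + y‖ ^ 2 / 4)

/-- The Laplacian of a function on `ℝ³`: the sum of the pure second derivatives
in the coordinate directions. -/
def lapl (f : EuclideanSpace ℝ (Fin 3) → ℝ) (x : EuclideanSpace ℝ (Fin 3)) : ℝ :=
  ∑ i : Fin 3,
    iteratedFDeriv ℝ 2 f x ![EuclideanSpace.single i (1 : ℝ), EuclideanSpace.single i (1 : ℝ)]

/-- The second derivative of a function of the form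
`z ↦ a * exp (-b * ‖z - y‖ ^ 2 - c * ‖z + y‖ ^ 2)`. -/
lemma iteratedFDeriv_two_gaussian {E : Type*} [NormedAddCommGroup E] [InnerProductSpace ℝ E]
    (a b c : ℝ) (x y v : E) :
    iteratedFDeriv ℝ 2 (fun z => a * Real.exp (-b * ‖z - y‖ ^ 2 - c * ‖z + y‖ ^ 2)) x ![v, v] =
      a * Real.exp (-b * ‖x - y‖ ^ 2 - c * ‖x + y‖ ^ 2) *
        ((2 * b * inner ℝ (x - y) v + 2 * c * inner ℝ (x + y) v) ^ 2
          - 2 * (b + c) * ‖v‖ ^ 2) := by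
  set f : E → ℝ := fun z => a * Real.exp (-b * ‖z - y‖ ^ 2 - c * ‖z + y‖ ^ 2) with hf
  obtain ⟨B, hB⟩ : ∃ B : E →L[ℝ] E →L[ℝ] ℝ, ∀ u w, B u w = inner ℝ u w :=
    ⟨innerSL ℝ, fun u w => innerSL_apply_apply ℝ u w⟩
  set L : E → (E →L[ℝ] ℝ) := fun z =>
    (-2 * b) • B (z - y) - (2 * c) • B (z + y) with hL
  have hderiv (z : E) : HasFDerivAt f (f z • L z) z := by
    have h₁ := (((hasFDerivAt_id z).sub_const y).norm_sq).const_mul (-b)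
    have h₂ := (((hasFDerivAt_id z).add_const y).norm_sq).const_mul c
    refine ((h₁.sub h₂).exp.const_mul a).congr_fderiv ?_
    ext w
    simp [hf, hL, hB]
    ring
  have hfderiv : fderiv ℝ f = fun z => f z • L z := funext fun z => (hderiv z).fderiv
  have hL' : HasFDerivAt L ((-2 * b) • B - (2 * c) • B) x := by
    have h₁ := (B.hasFDerivAt.comp x
      ((hasFDerivAt_id x).sub_const y)).const_smul (-2 * b)
    have h₂ := (B.hasFDerivAt.comp x
      ((hasFDerivAt_id x).add_const y)).const_smul (2 * c)
    exact h₁.sub h₂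
  have h2 : fderiv ℝ (fun z => f z • L z) x = _ := ((hderiv x).smul hL').fderiv
  rw [iteratedFDeriv_two_apply, hfderiv, h2]
  simp [hL, hf, hB, inner_add_left, inner_sub_left]
  ring

lemma lapl_mehlerK (t : ℝ) (x y : EuclideanSpace ℝ (Fin 3)) :
    lapl (fun z => mehlerK t z y) x =
      mehlerK t x y * (‖x - y‖ ^ 2 / (4 * Real.tanh t ^ 2) + Real.tanh t ^ 2 * ‖x + y‖ ^ 2 / 4
        + Real.tanh t * (Real.tanh t)⁻¹ * (‖x‖ ^ 2 - ‖y‖ ^ 2) / 2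
        - 3 * ((Real.tanh t)⁻¹ + Real.tanh t) / 2) := by
  have hK (z : EuclideanSpace ℝ (Fin 3)) : mehlerK t z y =
      (2 * π * Real.sinh (2 * t)) ^ (-(3 : ℝ) / 2) *
        Real.exp (-((Real.tanh t)⁻¹ / 4) * ‖z - y‖ ^ 2 - Real.tanh t / 4 * ‖z + y‖ ^ 2) := by
    rw [mehlerK]
    congr 2
    ring
  simp only [hK, lapl, iteratedFDeriv_two_gaussian, ← Finset.mul_sum]
  congr 1
  simp only [EuclideanSpace.real_norm_sq_eq, Fin.sum_univ_three, EuclideanSpace.inner_single_right]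
  simp
  ring

/-- The closed form of the harmonic oscillator applied to the Mehler kernel. -/
lemma neg_lapl_mehlerK_add {t : ℝ} (ht : Real.tanh t ≠ 0) (x y : EuclideanSpace ℝ (Fin 3)) :
    -(lapl (fun z => mehlerK t z y) x) + ‖x‖ ^ 2 * mehlerK t x y =
      mehlerK t x y * (3 * ((Real.tanh t)⁻¹ + Real.tanh t) / 2
        - ‖x - y‖ ^ 2 * ((Real.tanh t ^ 2)⁻¹ - 1) / 4
        + ‖x + y‖ ^ 2 * (1 - Real.tanh t ^ 2) / 4) := by
  have hpar := parallelogram_law_with_norm ℝ x y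
  rw [lapl_mehlerK, mul_inv_cancel₀ ht]
  linear_combination (-mehlerK t x y / 4) * hpar

lemma mul_exp_neg_le_one (u : ℝ) : u * Real.exp (-u) ≤ 1 := by
  rw [Real.exp_neg, ← div_eq_mul_inv, div_le_one (Real.exp_pos u)]
  linarith [Real.add_one_le_exp u]

/-- With `τ = tanh t`, `p = ‖x - y‖ ^ 2` and `q = ‖x + y‖ ^ 2`, this bounds the Gaussian factor
times the polynomial factor of the harmonic oscillator applied to the Mehler kernel. -/
lemma abs_exp_mul_le {τ p q : ℝ} (hτ : 0 < τ) (hτ1 : τ ≤ 1) (hp : 0 ≤ p) (hq : 0 ≤ q) :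
    |Real.exp (-p / (4 * τ) - τ * q / 4) *
        (3 * (τ⁻¹ + τ) / 2 - p * ((τ ^ 2)⁻¹ - 1) / 4 + q * (1 - τ ^ 2) / 4)| ≤
      6 * τ⁻¹ * Real.exp (-p / (8 * τ)) := by
  set u := p / (8 * τ) with hu
  set w := τ * q / 4 with hw
  have hu0 : 0 ≤ u := by positivity
  have hw0 : 0 ≤ w := by positivity
  have hi : 1 ≤ τ⁻¹ := (one_le_inv₀ hτ).mpr hτ1
  have hsplit : Real.exp (-p / (4 * τ) - w) =
      Real.exp (-p / (8 * τ)) * (Real.exp (-u) * Real.exp (-w)) := by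
    rw [← Real.exp_add, ← Real.exp_add]
    congr 1
    rw [hu]
    field_simp
    ring
  have hpu : p * ((τ ^ 2)⁻¹ - 1) / 4 = 2 * τ⁻¹ * (1 - τ ^ 2) * u := by
    rw [hu]
    field_simp
    ring
  have hqw : q * (1 - τ ^ 2) / 4 = τ⁻¹ * (1 - τ ^ 2) * w := by
    rw [hw]
    field_simp
  have hs0 : 0 ≤ 1 - τ ^ 2 := by nlinarith
  have hs1 : 1 - τ ^ 2 ≤ 1 := by nlinarith
  have heu : Real.exp (-u) ≤ 1 := Real.exp_le_one_iff.mpr (by linarith)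
  have hew : Real.exp (-w) ≤ 1 := Real.exp_le_one_iff.mpr (by linarith)
  have h₁ : Real.exp (-u) * Real.exp (-w) ≤ 1 := mul_le_one₀ heu (Real.exp_pos _).le hew
  have h₂ : u * Real.exp (-u) * Real.exp (-w) ≤ 1 :=
    mul_le_one₀ (mul_exp_neg_le_one u) (Real.exp_pos _).le hew
  have h₃ : Real.exp (-u) * (w * Real.exp (-w)) ≤ 1 :=
    mul_le_one₀ heu (by positivity) (mul_exp_neg_le_one w)
  rw [hsplit, hpu, hqw, mul_assoc, abs_mul, abs_of_pos (Real.exp_pos _), mul_comm (6 * τ⁻¹)]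
  refine mul_le_mul_of_nonneg_left ?_ (Real.exp_pos _).le
  have b₁ : 3 * (τ⁻¹ + τ) / 2 * (Real.exp (-u) * Real.exp (-w)) ≤ 3 * τ⁻¹ * 1 := by
    gcongr
    linarith
  have b₂ : 2 * τ⁻¹ * (1 - τ ^ 2) * (u * Real.exp (-u) * Real.exp (-w)) ≤ 2 * τ⁻¹ * 1 * 1 := by
    gcongr
  have b₃ : τ⁻¹ * (1 - τ ^ 2) * (Real.exp (-u) * (w * Real.exp (-w))) ≤ τ⁻¹ * 1 * 1 := by
    gcongr
  have c₁ : 0 ≤ 3 * (τ⁻¹ + τ) / 2 * (Real.exp (-u) * Real.exp (-w)) := by positivity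
  have c₂ : 0 ≤ 2 * τ⁻¹ * (1 - τ ^ 2) * (u * Real.exp (-u) * Real.exp (-w)) := by positivity
  have c₃ : 0 ≤ τ⁻¹ * (1 - τ ^ 2) * (Real.exp (-u) * (w * Real.exp (-w))) := by positivity
  rw [abs_le]
  constructor <;> linarith

lemma inv_tanh_le {t : ℝ} (ht : 0 < t) (ht1 : t ≤ 1) :
    (Real.tanh t)⁻¹ ≤ Real.cosh 1 * t⁻¹ := by
  rw [Real.tanh_eq_sinh_div_cosh, inv_div, div_eq_mul_inv]
  have hc : Real.cosh t ≤ Real.cosh 1 :=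
    Real.cosh_le_cosh.mpr (by rwa [abs_of_pos ht, abs_one])
  have hs : t ≤ Real.sinh t := Real.self_le_sinh_iff.mpr ht.le
  have := Real.cosh_pos 1
  gcongr

lemma rpow_two_pi_sinh_le {t : ℝ} (ht : 0 < t) :
    (2 * π * Real.sinh (2 * t)) ^ (-(3 : ℝ) / 2) ≤ t ^ (-(3 : ℝ) / 2) := by
  refine Real.rpow_le_rpow_of_nonpos ht ?_ (by norm_num)
  have hs : 2 * t ≤ Real.sinh (2 * t) := Real.self_le_sinh_iff.mpr (by positivity)
  have hπ := Real.pi_gt_three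
  nlinarith [mul_le_mul (show (1 : ℝ) ≤ 2 * π by linarith) hs (by positivity) (by positivity)]

/-- `|H_{y₁} K_σ(y₁,y₂)| ≤ C σ^{-5/2} exp(-|y₁-y₂|²/(8 tanh σ))`
for `0 < σ ≤ 1`. -/
theorem harmonic_oscillator_heat_kernel_bound :
    ∃ C : ℝ, 0 < C ∧
      ∀ σ : ℝ, 0 < σ → σ ≤ 1 → ∀ y₁ y₂ : EuclideanSpace ℝ (Fin 3),
        |(-(lapl (fun z => mehlerK σ z y₂) y₁) + ‖y₁‖ ^ 2 * mehlerK σ y₁ y₂)| ≤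
          C * σ ^ (-(5 : ℝ) / 2) * Real.exp (-‖y₁ - y₂‖ ^ 2 / (8 * Real.tanh σ)) := by
  refine ⟨6 * Real.cosh 1, by have := Real.cosh_pos 1; positivity, fun σ hσ hσ1 x y => ?_⟩
  have hτ : 0 < Real.tanh σ := by
    rw [Real.tanh_eq_sinh_div_cosh]
    exact div_pos (Real.sinh_pos_iff.mpr hσ) (Real.cosh_pos σ)
  have hpow : σ ^ (-(5 : ℝ) / 2) = σ ^ (-(3 : ℝ) / 2) * σ⁻¹ := by
    rw [← Real.rpow_neg_one σ, ← Real.rpow_add hσ]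
    norm_num
  have hA : 0 ≤ (2 * π * Real.sinh (2 * σ)) ^ (-(3 : ℝ) / 2) :=
    Real.rpow_nonneg (mul_nonneg (by positivity) (Real.sinh_nonneg_iff.mpr (by positivity))) _
  rw [neg_lapl_mehlerK_add hτ.ne', mehlerK, mul_assoc, abs_mul, abs_of_nonneg hA]
  calc (2 * π * Real.sinh (2 * σ)) ^ (-(3 : ℝ) / 2) * _
    _ ≤ σ ^ (-(3 : ℝ) / 2) *
        (6 * (Real.cosh 1 * σ⁻¹) * Real.exp (-‖x - y‖ ^ 2 / (8 * Real.tanh σ))) := by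
      refine mul_le_mul (rpow_two_pi_sinh_le hσ) ?_ (abs_nonneg _) (by positivity)
      refine (abs_exp_mul_le hτ (Real.tanh_lt_one σ).le (by positivity) (by positivity)).trans ?_
      gcongr
      exact inv_tanh_le hσ hσ1
    _ = _ := by
      rw [hpow]
      ring

end
end

section
/- For every integer n ≥ 1 there exists a constant C_n > 0 such that for all 0 < σ ≤ 1 and all y₁, y₂ ∈ ℝ³, one has |(H_{y₁}^n K_σ)(y₁,y₂)| ≤ C_n · σ^{−3/2−n} · exp(−|y₁−y₂|²/(8·tanh σ)), where H_{y₁} is the harmonic-oscillator operator acting in the first variable, (H_{y₁} f)(y₁,y₂) = −(Δ_{y₁} f)(y₁,y₂) + |y₁|²·f(y₁,y₂), and H_{y₁}^n denotes its n-fold iteration. -/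
open MeasureTheory Real

noncomputable section

/-- The harmonic oscillator `H = -Δ + |x|²` acting on functions on `ℝ³`. -/
def Hop (f : EuclideanSpace ℝ (Fin 3) → ℝ) : EuclideanSpace ℝ (Fin 3) → ℝ :=
  fun x => -lapl f x + ‖x‖ ^ 2 * f x

/-- The Gaussian factor of the Mehler kernel, in terms of `r = √(tanh t)`. -/
def mehlerGauss (r : ℝ) (y x : EuclideanSpace ℝ (Fin 3)) : ℝ :=
  Real.exp (-‖x - y‖ ^ 2 / (4 * r ^ 2) - r ^ 2 * ‖x + y‖ ^ 2 / 4)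

/-- Families of polynomials in the rescaled variables `(x - y) / r` and `r (x + y)` whose
coefficients are `O(r⁻ᵏ)` as `r → 0`. -/
inductive MehlerSymbol :
    ℕ → (ℝ → EuclideanSpace ℝ (Fin 3) → EuclideanSpace ℝ (Fin 3) → ℝ) → Prop
  | const (c : ℝ) : MehlerSymbol 0 (fun _ _ _ => c)
  | diff (i : Fin 3) : MehlerSymbol 0 (fun r y x => r⁻¹ * (x i - y i))
  | sum (i : Fin 3) : MehlerSymbol 0 (fun r y x => r * (x i + y i))
  | scale {k f} : MehlerSymbol k f → MehlerSymbol k (fun r y x => r * f r y x)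
  | inv_scale {k f} : MehlerSymbol k f → MehlerSymbol (k + 1) (fun r y x => r⁻¹ * f r y x)
  | lift {k f} : MehlerSymbol k f → MehlerSymbol (k + 1) f
  | add {k f g} : MehlerSymbol k f → MehlerSymbol k g →
      MehlerSymbol k (fun r y x => f r y x + g r y x)
  | mul {k l f g} : MehlerSymbol k f → MehlerSymbol l g →
      MehlerSymbol (k + l) (fun r y x => f r y x * g r y x)

namespace MehlerSymbol

variable {k : ℕ} {f : ℝ → EuclideanSpace ℝ (Fin 3) → EuclideanSpace ℝ (Fin 3) → ℝ}

lemma const_mul (c : ℝ) (hf : MehlerSymbol k f) :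
    MehlerSymbol k (fun r y x => c * f r y x) := by
  simpa using (MehlerSymbol.const c).mul hf

lemma contDiff (hf : MehlerSymbol k f) (r : ℝ) (y : EuclideanSpace ℝ (Fin 3)) :
    ContDiff ℝ 2 (f r y) := by
  induction hf with
  | const c => exact contDiff_const
  | diff i => fun_prop
  | sum i => fun_prop
  | scale _ ih => exact contDiff_const.mul ih
  | inv_scale _ ih => exact contDiff_const.mul ih
  | lift _ ih => exact ih
  | add _ _ ih₁ ih₂ => exact ih₁.add ih₂
  | mul _ _ ih₁ ih₂ => exact ih₁.mul ih₂

lemma differentiable (hf : MehlerSymbol k f) (r : ℝ) (y : EuclideanSpace ℝ (Fin 3)) :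
    Differentiable ℝ (f r y) :=
  (hf.contDiff r y).differentiable (by norm_num)

lemma exists_fderiv (hf : MehlerSymbol k f) (i : Fin 3) :
    ∃ g, MehlerSymbol (k + 1) g ∧ ∀ r y x,
      fderiv ℝ (f r y) x (EuclideanSpace.single i 1) = g r y x := by
  have hcoord : ∀ (j : Fin 3) (x : EuclideanSpace ℝ (Fin 3)),
      HasFDerivAt (fun z : EuclideanSpace ℝ (Fin 3) => z j)
        (EuclideanSpace.proj j : EuclideanSpace ℝ (Fin 3) →L[ℝ] ℝ) x := fun j x =>
    (EuclideanSpace.proj j : EuclideanSpace ℝ (Fin 3) →L[ℝ] ℝ).hasFDerivAt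
  induction hf with
  | const c => exact ⟨_, (const 0).lift, fun r y x => by simp⟩
  | diff j =>
    refine ⟨_, (const ((EuclideanSpace.single i (1 : ℝ) : EuclideanSpace ℝ (Fin 3)) j)).inv_scale,
      fun r y x => ?_⟩
    rw [(((hcoord j x).sub_const (y j)).const_mul r⁻¹).fderiv]
    simp
  | sum j =>
    refine ⟨_, (const ((EuclideanSpace.single i (1 : ℝ) : EuclideanSpace ℝ (Fin 3)) j)).scale.lift,
      fun r y x => ?_⟩
    rw [(((hcoord j x).add_const (y j)).const_mul r).fderiv]
    simp
  | scale hf ih =>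
    obtain ⟨g, hg, h⟩ := ih
    refine ⟨_, hg.scale, fun r y x => ?_⟩
    rw [fderiv_const_mul (hf.differentiable r y x)]
    simp [h]
  | inv_scale hf ih =>
    obtain ⟨g, hg, h⟩ := ih
    refine ⟨_, hg.inv_scale, fun r y x => ?_⟩
    rw [fderiv_const_mul (hf.differentiable r y x)]
    simp [h]
  | lift _ ih =>
    obtain ⟨g, hg, h⟩ := ih
    exact ⟨g, hg.lift, h⟩
  | add hf₁ hf₂ ih₁ ih₂ =>
    obtain ⟨g₁, hg₁, h₁⟩ := ih₁
    obtain ⟨g₂, hg₂, h₂⟩ := ih₂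
    refine ⟨_, hg₁.add hg₂, fun r y x => ?_⟩
    rw [fderiv_fun_add (hf₁.differentiable r y x) (hf₂.differentiable r y x)]
    simp [h₁, h₂]
  | @mul k l f₁ f₂ hf₁ hf₂ ih₁ ih₂ =>
    obtain ⟨g₁, hg₁, h₁⟩ := ih₁
    obtain ⟨g₂, hg₂, h₂⟩ := ih₂
    have hsum : MehlerSymbol (k + l + 1)
        (fun r y x => f₁ r y x * g₂ r y x + f₂ r y x * g₁ r y x) :=
      (hf₁.mul hg₂).add ((by omega : l + (k + 1) = k + (l + 1)) ▸ hf₂.mul hg₁)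
    refine ⟨_, hsum, fun r y x => ?_⟩
    rw [fderiv_fun_mul (hf₁.differentiable r y x) (hf₂.differentiable r y x)]
    simp [h₁, h₂]

lemma exists_bound (hf : MehlerSymbol k f) :
    ∃ C : ℝ, 0 ≤ C ∧ ∃ m : ℕ, ∀ r y x, 0 < r → r ≤ 1 →
      |f r y x| ≤ C * r⁻¹ ^ k * (1 + (‖x - y‖ ^ 2 / r ^ 2 + r ^ 2 * ‖x + y‖ ^ 2)) ^ m := by
  have hcoord : ∀ (i : Fin 3) (z : EuclideanSpace ℝ (Fin 3)), z i ^ 2 ≤ ‖z‖ ^ 2 := fun i z =>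
    sq_le_sq.2 (by simpa using PiLp.norm_apply_le z i)
  have habs : ∀ a b : ℝ, a ^ 2 ≤ b → |a| ≤ 1 + b := fun a b h => by
    nlinarith [sq_nonneg (|a| - 1), sq_abs a, abs_nonneg a]
  induction hf with
  | const c => exact ⟨|c|, abs_nonneg c, 0, fun r y x _ _ => by simp⟩
  | diff i =>
    refine ⟨1, zero_le_one, 1, fun r y x hr _ => ?_⟩
    simp only [pow_zero, pow_one, one_mul]
    refine habs _ _ ?_
    have h₁ : (r⁻¹ * (x i - y i)) ^ 2 ≤ ‖x - y‖ ^ 2 / r ^ 2 := by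
      rw [mul_pow, inv_pow, inv_mul_eq_div]
      exact div_le_div_of_nonneg_right (hcoord i (x - y)) (sq_nonneg r)
    have h₂ : 0 ≤ r ^ 2 * ‖x + y‖ ^ 2 := by positivity
    linarith
  | sum i =>
    refine ⟨1, zero_le_one, 1, fun r y x hr _ => ?_⟩
    simp only [pow_zero, pow_one, one_mul]
    refine habs _ _ ?_
    have h₁ : (r * (x i + y i)) ^ 2 ≤ r ^ 2 * ‖x + y‖ ^ 2 := by
      rw [mul_pow]
      exact mul_le_mul_of_nonneg_left (hcoord i (x + y)) (sq_nonneg r)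
    have h₂ : 0 ≤ ‖x - y‖ ^ 2 / r ^ 2 := by positivity
    linarith
  | scale _ ih =>
    obtain ⟨C, hC, m, h⟩ := ih
    refine ⟨C, hC, m, fun r y x hr hr1 => ?_⟩
    rw [abs_mul, abs_of_pos hr]
    exact (mul_le_of_le_one_left (abs_nonneg _) hr1).trans (h r y x hr hr1)
  | inv_scale _ ih =>
    obtain ⟨C, hC, m, h⟩ := ih
    refine ⟨C, hC, m, fun r y x hr hr1 => ?_⟩
    rw [abs_mul, abs_of_pos (inv_pos.2 hr)]
    calc _ ≤ r⁻¹ * _ := mul_le_mul_of_nonneg_left (h r y x hr hr1) (inv_pos.2 hr).le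
      _ = _ := by ring
  | lift _ ih =>
    obtain ⟨C, hC, m, h⟩ := ih
    refine ⟨C, hC, m, fun r y x hr hr1 => (h r y x hr hr1).trans ?_⟩
    have := (one_le_inv₀ hr).2 hr1
    gcongr
    omega
  | @add k f₁ f₂ _ _ ih₁ ih₂ =>
    obtain ⟨C₁, hC₁, m₁, h₁⟩ := ih₁
    obtain ⟨C₂, hC₂, m₂, h₂⟩ := ih₂
    refine ⟨C₁ + C₂, by positivity, m₁ + m₂, fun r y x hr hr1 => (abs_add_le _ _).trans ?_⟩
    have hT : 1 ≤ 1 + (‖x - y‖ ^ 2 / r ^ 2 + r ^ 2 * ‖x + y‖ ^ 2) :=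
      le_add_of_nonneg_right (by positivity)
    rw [add_mul, add_mul]
    refine add_le_add ((h₁ r y x hr hr1).trans ?_) ((h₂ r y x hr hr1).trans ?_)
    · gcongr
      omega
    · gcongr
      omega
  | @mul k l f₁ f₂ _ _ ih₁ ih₂ =>
    obtain ⟨C₁, hC₁, m₁, h₁⟩ := ih₁
    obtain ⟨C₂, hC₂, m₂, h₂⟩ := ih₂
    refine ⟨C₁ * C₂, by positivity, m₁ + m₂, fun r y x hr hr1 => ?_⟩
    rw [abs_mul]
    calc _ ≤ _ := mul_le_mul (h₁ r y x hr hr1) (h₂ r y x hr hr1) (abs_nonneg _) (by positivity)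
      _ = _ := by ring

end MehlerSymbol

lemma contDiff_mehlerGauss (r : ℝ) (y : EuclideanSpace ℝ (Fin 3)) :
    ContDiff ℝ 2 (mehlerGauss r y) := by
  unfold mehlerGauss
  have h₁ : ContDiff ℝ 2 (fun x : EuclideanSpace ℝ (Fin 3) => ‖x - y‖ ^ 2) :=
    (contDiff_id.sub contDiff_const).norm_sq ℝ
  have h₂ : ContDiff ℝ 2 (fun x : EuclideanSpace ℝ (Fin 3) => ‖x + y‖ ^ 2) :=
    (contDiff_id.add contDiff_const).norm_sq ℝ
  fun_prop

lemma fderiv_mehlerGauss (r : ℝ) (y x : EuclideanSpace ℝ (Fin 3)) (i : Fin 3) :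
    fderiv ℝ (mehlerGauss r y) x (EuclideanSpace.single i 1) =
      (-1 / 2) * (r⁻¹ * (r⁻¹ * (x i - y i)) + r * (r * (x i + y i))) * mehlerGauss r y x := by
  have h₁ := ((hasFDerivAt_id (𝕜 := ℝ) x).sub_const y).norm_sq
  have h₂ := ((hasFDerivAt_id (𝕜 := ℝ) x).add_const y).norm_sq
  have h := ((h₁.neg.mul_const (4 * r ^ 2)⁻¹).sub ((h₂.const_mul (r ^ 2)).mul_const 4⁻¹)).exp
  have h' : HasFDerivAt (mehlerGauss r y) _ x := h
  rw [h'.fderiv]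
  simp [mehlerGauss, div_eq_mul_inv, EuclideanSpace.inner_single_right]
  ring

/-- Symbols times the Gaussian are closed under differentiation, with a loss of one order. -/
lemma MehlerSymbol.exists_fderiv_mul_gauss {k : ℕ}
    {f : ℝ → EuclideanSpace ℝ (Fin 3) → EuclideanSpace ℝ (Fin 3) → ℝ}
    (hf : MehlerSymbol k f) (i : Fin 3) :
    ∃ g, MehlerSymbol (k + 1) g ∧ ∀ r y x,
      fderiv ℝ (fun z => f r y z * mehlerGauss r y z) x (EuclideanSpace.single i 1) =
        g r y x * mehlerGauss r y x := by
  obtain ⟨g, hg, h⟩ := hf.exists_fderiv i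
  refine ⟨_, hg.add (hf.mul
    (((MehlerSymbol.diff i).inv_scale.add (MehlerSymbol.sum i).scale.lift).const_mul (-1 / 2))),
    fun r y x => ?_⟩
  rw [fderiv_fun_mul (hf.differentiable r y x)
    ((contDiff_mehlerGauss r y).differentiable (by norm_num) x)]
  simp only [add_apply, smul_apply, smul_eq_mul, h,
    fderiv_mehlerGauss]
  ring

lemma lapl_eq_sum_fderiv {F : EuclideanSpace ℝ (Fin 3) → ℝ} (hF : ContDiff ℝ 2 F)
    (x : EuclideanSpace ℝ (Fin 3)) :
    lapl F x = ∑ i : Fin 3, fderiv ℝ (fun z => fderiv ℝ F z (EuclideanSpace.single i 1)) x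
      (EuclideanSpace.single i 1) := by
  refine Finset.sum_congr rfl fun i _ => ?_
  have hd : DifferentiableAt ℝ (fderiv ℝ F) x :=
    (hF.fderiv_right (m := 1) (by norm_num)).differentiable (by norm_num) x
  rw [iteratedFDeriv_two_apply, fderiv_clm_apply hd (differentiableAt_const _)]
  simp

lemma Hop_const_mul {F : EuclideanSpace ℝ (Fin 3) → ℝ} (hF : ContDiff ℝ 2 F) (A : ℝ) :
    Hop (fun z => A * F z) = fun z => A * Hop F z := by
  funext x
  have h : lapl (fun z => A * F z) x = A * lapl F x := by
    simp only [lapl, Finset.mul_sum]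
    refine Finset.sum_congr rfl fun i _ => ?_
    have := iteratedFDeriv_const_smul_apply (𝕜 := ℝ) (a := A) (i := 2) (x := x) hF.contDiffAt
    exact congrArg
      (fun T => T ![EuclideanSpace.single i (1 : ℝ), EuclideanSpace.single i (1 : ℝ)]) this
  simp only [Hop, h]
  ring

/-- The harmonic oscillator maps symbols times the Gaussian to symbols times the Gaussian, with a
loss of two orders. -/
lemma MehlerSymbol.exists_Hop_mul_gauss {k : ℕ}
    {f : ℝ → EuclideanSpace ℝ (Fin 3) → EuclideanSpace ℝ (Fin 3) → ℝ} (hf : MehlerSymbol k f) :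
    ∃ g, MehlerSymbol (k + 2) g ∧ ∀ r y, r ≠ 0 →
      Hop (fun z => f r y z * mehlerGauss r y z) = fun z => g r y z * mehlerGauss r y z := by
  choose g hg hfg using fun i => hf.exists_fderiv_mul_gauss i
  choose g' hg' hgg' using fun i => (hg i).exists_fderiv_mul_gauss i
  have hx : ∀ i : Fin 3, MehlerSymbol 1
      (fun r y x => (1 / 2) * (r * (r⁻¹ * (x i - y i)) + r⁻¹ * (r * (x i + y i)))) := fun i =>
    ((MehlerSymbol.diff i).scale.lift.add (MehlerSymbol.sum i).inv_scale).const_mul _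
  have hlap := (((hg' 0).add (hg' 1)).add (hg' 2)).const_mul (-1)
  have hpot := hf.mul
    ((((hx 0).mul (hx 0)).add ((hx 1).mul (hx 1))).add ((hx 2).mul (hx 2)))
  refine ⟨_, hlap.add hpot, fun r y hr => funext fun x => ?_⟩
  have hcoord : ∀ i : Fin 3,
      (1 / 2) * (r * (r⁻¹ * (x i - y i)) + r⁻¹ * (r * (x i + y i))) = x i := fun i => by
    field_simp
    ring
  simp only [Hop, hcoord, lapl_eq_sum_fderiv ((hf.contDiff r y).mul (contDiff_mehlerGauss r y)),
    hfg, hgg', EuclideanSpace.norm_sq_eq, Fin.sum_univ_three, Real.norm_eq_abs, sq_abs]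
  ring

lemma exists_iterate_Hop_mehlerGauss (n : ℕ) :
    ∃ g, MehlerSymbol (2 * n) g ∧ ∀ A r y, r ≠ 0 →
      Hop^[n] (fun z => A * mehlerGauss r y z) =
        fun z => A * (g r y z * mehlerGauss r y z) := by
  induction n with
  | zero => exact ⟨_, MehlerSymbol.const 1, fun A r y _ => by simp⟩
  | succ n ih =>
    obtain ⟨g, hg, h⟩ := ih
    obtain ⟨g', hg', h'⟩ := hg.exists_Hop_mul_gauss
    refine ⟨g', hg', fun A r y hr => ?_⟩
    rw [Function.iterate_succ_apply', h A r y hr,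
      Hop_const_mul ((hg.contDiff r y).mul (contDiff_mehlerGauss r y)), h' r y hr]

lemma one_add_pow_mul_exp_le (m : ℕ) {T : ℝ} (hT : 0 ≤ T) :
    (1 + T) ^ m * Real.exp (-T / 8) ≤ 8 ^ m * m.factorial * Real.exp (1 / 8) := by
  have h := Real.pow_div_factorial_le_exp ((1 + T) / 8) (by positivity) m
  rw [div_pow, div_div, div_le_iff₀ (by positivity)] at h
  calc (1 + T) ^ m * Real.exp (-T / 8)
      ≤ Real.exp ((1 + T) / 8) * (8 ^ m * m.factorial) * Real.exp (-T / 8) := by gcongr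
    _ = 8 ^ m * m.factorial * (Real.exp ((1 + T) / 8) * Real.exp (-T / 8)) := by ring
    _ = _ := by
      rw [← Real.exp_add]
      congr 2
      ring

/-- Half of the off-diagonal Gaussian decay absorbs the polynomial growth of a symbol. -/
lemma MehlerSymbol.exists_mul_gauss_bound {k : ℕ}
    {f : ℝ → EuclideanSpace ℝ (Fin 3) → EuclideanSpace ℝ (Fin 3) → ℝ} (hf : MehlerSymbol k f) :
    ∃ C : ℝ, 0 ≤ C ∧ ∀ r y x, 0 < r → r ≤ 1 →
      |f r y x * mehlerGauss r y x| ≤ C * r⁻¹ ^ k * Real.exp (-‖x - y‖ ^ 2 / (8 * r ^ 2)) := by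
  obtain ⟨C, hC, m, h⟩ := hf.exists_bound
  refine ⟨C * (8 ^ m * m.factorial * Real.exp (1 / 8)), by positivity, fun r y x hr hr1 => ?_⟩
  set T := ‖x - y‖ ^ 2 / r ^ 2 + r ^ 2 * ‖x + y‖ ^ 2 with hT
  have hT0 : 0 ≤ T := by positivity
  have hgauss : mehlerGauss r y x ≤
      Real.exp (-T / 8) * Real.exp (-‖x - y‖ ^ 2 / (8 * r ^ 2)) := by
    rw [mehlerGauss, ← Real.exp_add, Real.exp_le_exp]
    have h₁ : 0 ≤ r ^ 2 * ‖x + y‖ ^ 2 := by positivity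
    have h₂ : -‖x - y‖ ^ 2 / (4 * r ^ 2) = -(‖x - y‖ ^ 2 / r ^ 2) / 4 := by field_simp
    have h₃ : -‖x - y‖ ^ 2 / (8 * r ^ 2) = -(‖x - y‖ ^ 2 / r ^ 2) / 8 := by field_simp
    rw [h₂, h₃, hT]
    linarith
  have hpos : 0 ≤ mehlerGauss r y x := (Real.exp_pos _).le
  rw [abs_mul, abs_of_nonneg hpos]
  calc |f r y x| * mehlerGauss r y x
      ≤ (C * r⁻¹ ^ k * (1 + T) ^ m) *
          (Real.exp (-T / 8) * Real.exp (-‖x - y‖ ^ 2 / (8 * r ^ 2))) :=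
        mul_le_mul (h r y x hr hr1) hgauss hpos (by positivity)
    _ = C * r⁻¹ ^ k * ((1 + T) ^ m * Real.exp (-T / 8)) *
          Real.exp (-‖x - y‖ ^ 2 / (8 * r ^ 2)) := by ring
    _ ≤ C * r⁻¹ ^ k * (8 ^ m * m.factorial * Real.exp (1 / 8)) *
          Real.exp (-‖x - y‖ ^ 2 / (8 * r ^ 2)) := by
        have := one_add_pow_mul_exp_le m hT0
        exact mul_le_mul_of_nonneg_right (mul_le_mul_of_nonneg_left this (by positivity))
          (Real.exp_pos _).le
    _ = _ := by ring

lemma div_cosh_one_le_tanh {σ : ℝ} (h0 : 0 < σ) (h1 : σ ≤ 1) :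
    σ / Real.cosh 1 ≤ Real.tanh σ := by
  rw [Real.tanh_eq_sinh_div_cosh]
  have hcosh : Real.cosh σ ≤ Real.cosh 1 := by
    rw [Real.cosh_le_cosh, abs_of_pos h0, abs_one]
    exact h1
  have hsinh : σ ≤ Real.sinh σ := Real.self_le_sinh_iff.2 h0.le
  exact div_le_div₀ (h0.le.trans hsinh) hsinh (Real.cosh_pos σ) hcosh

lemma mehler_prefactor_le {σ : ℝ} (h0 : 0 < σ) :
    (2 * π * Real.sinh (2 * σ)) ^ (-(3 : ℝ) / 2) ≤ σ ^ (-(3 : ℝ) / 2) := by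
  refine Real.rpow_le_rpow_of_nonpos h0 ?_ (by norm_num)
  have hsinh : 2 * σ ≤ Real.sinh (2 * σ) := Real.self_le_sinh_iff.2 (by positivity)
  nlinarith [Real.pi_gt_three]

/-- for every `n ≥ 1`, `|H_{y₁}^n K_σ(y₁,y₂)| ≤ C_n σ^{-3/2-n}
exp(-|y₁-y₂|²/(8 tanh σ))` for `0 < σ ≤ 1`, where `H_{y₁}^n` is the `n`-fold iterate of the
harmonic oscillator in the first variable. -/
theorem harmonic_oscillator_iterated_heat_kernel_bound (n : ℕ) (hn : 1 ≤ n) :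
    ∃ C : ℝ, 0 < C ∧
      ∀ σ : ℝ, 0 < σ → σ ≤ 1 → ∀ y₁ y₂ : EuclideanSpace ℝ (Fin 3),
        |(Hop^[n] (fun z => mehlerK σ z y₂)) y₁| ≤
          C * σ ^ (-(3 : ℝ) / 2 - (n : ℝ)) * Real.exp (-‖y₁ - y₂‖ ^ 2 / (8 * Real.tanh σ)) := by
  obtain ⟨g, hg, hiter⟩ := exists_iterate_Hop_mehlerGauss n
  obtain ⟨C, hC, hbound⟩ := hg.exists_mul_gauss_bound
  refine ⟨C * Real.cosh 1 ^ n + 1, by positivity, fun σ h0 h1 y₁ y₂ => ?_⟩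
  have htanh := div_cosh_one_le_tanh h0 h1
  have htanh0 : 0 < Real.tanh σ := lt_of_lt_of_le (by positivity) htanh
  set r := √(Real.tanh σ) with hr
  have hr0 : 0 < r := Real.sqrt_pos.2 htanh0
  have hr1 : r ≤ 1 := Real.sqrt_le_one.2 (Real.tanh_lt_one σ).le
  have hr2 : r ^ 2 = Real.tanh σ := Real.sq_sqrt htanh0.le
  have hA0 : 0 ≤ (2 * π * Real.sinh (2 * σ)) ^ (-(3 : ℝ) / 2) :=
    Real.rpow_nonneg (mul_nonneg (by positivity) (Real.sinh_nonneg_iff.2 (by positivity))) _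
  have hkernel : (fun z => mehlerK σ z y₂) = fun z =>
      (2 * π * Real.sinh (2 * σ)) ^ (-(3 : ℝ) / 2) * mehlerGauss r y₂ z := by
    funext z
    rw [mehlerK, mehlerGauss, hr2]
  have hpow : r⁻¹ ^ (2 * n) ≤ Real.cosh 1 ^ n * σ ^ (-(n : ℝ)) := by
    rw [pow_mul, inv_pow, hr2, Real.rpow_neg h0.le, Real.rpow_natCast, ← inv_pow, ← mul_pow]
    gcongr
    rw [← div_eq_mul_inv, ← inv_div]
    exact inv_anti₀ (by positivity) htanh
  rw [hkernel, hiter _ r y₂ hr0.ne', abs_mul, abs_of_nonneg hA0, sub_eq_add_neg,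
    Real.rpow_add h0, ← hr2]
  calc _ ≤ σ ^ (-(3 : ℝ) / 2) * (C * (Real.cosh 1 ^ n * σ ^ (-(n : ℝ))) *
        Real.exp (-‖y₁ - y₂‖ ^ 2 / (8 * r ^ 2))) := by
        refine mul_le_mul (mehler_prefactor_le h0) ((hbound r y₂ y₁ hr0 hr1).trans ?_)
          (abs_nonneg _) (by positivity)
        gcongr
    _ = C * Real.cosh 1 ^ n * (σ ^ (-(3 : ℝ) / 2) * σ ^ (-(n : ℝ))) *
        Real.exp (-‖y₁ - y₂‖ ^ 2 / (8 * r ^ 2)) := by ring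
    _ ≤ _ := by
        gcongr
        linarith

end
end

section
/- For every p ∈ [1, ∞) there exists a constant C_p > 0, independent of the times, such that for all t₁, t₂ ≥ 0 with t₁ ≠ t₂ and all integers n ≥ 1, one has (∫_{ℝ³×ℝ³} 𝒞⁽ⁿ⁾_{t₁,t₂}(y₁,y₂)^p dy₁ dy₂)^{1/p} ≤ C_p · |t₂−t₁|^{−1/2}; moreover there exists C > 0 such that sup_{y₁,y₂ ∈ ℝ³} 𝒞⁽ⁿ⁾_{t₁,t₂}(y₁,y₂) ≤ C · |t₂−t₁|^{−1/2} for all such t₁, t₂ and n. -/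
open MeasureTheory Real

noncomputable section

/-- The regularized covariance `𝒞⁽ⁿ⁾_{t₁,t₂}(y₁,y₂)`, with `ε_n = 2^{-n}`. -/
def covC (n : ℕ) (t₁ t₂ : ℝ) (y₁ y₂ : EuclideanSpace ℝ (Fin 3)) : ℝ :=
  (1 / 2) * ∫ σ in (|t₂ - t₁| + 2 * (2 : ℝ) ^ (-(n : ℝ)))..(t₁ + t₂ + 2 * (2 : ℝ) ^ (-(n : ℝ))),
    mehlerK σ y₁ y₂

/-- The Gaussian factor of the Mehler kernel, with `T` in place of `tanh t`. -/
def mehlerGaussian (T : ℝ) (x y : EuclideanSpace ℝ (Fin 3)) : ℝ :=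
  Real.exp (-‖x - y‖ ^ 2 / (4 * T) - T * ‖x + y‖ ^ 2 / 4)

theorem lintegral_exp_neg_mul_norm_sq {b : ℝ} (hb : 0 < b) :
    ∫⁻ v : EuclideanSpace ℝ (Fin 3), ENNReal.ofReal (Real.exp (-b * ‖v‖ ^ 2)) =
      ENNReal.ofReal ((π / b) ^ ((3 : ℝ) / 2)) := by
  have h := GaussianFourier.integral_rexp_neg_mul_sq_norm (V := EuclideanSpace ℝ (Fin 3)) hb
  have h3 : ∫ v : EuclideanSpace ℝ (Fin 3), Real.exp (-b * ‖v‖ ^ 2) = (π / b) ^ ((3 : ℝ) / 2) := by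
    simpa using h
  have hpos : 0 < (π / b) ^ ((3 : ℝ) / 2) := by positivity
  have hint : Integrable fun v : EuclideanSpace ℝ (Fin 3) => Real.exp (-b * ‖v‖ ^ 2) :=
    .of_integral_ne_zero (by rw [h3]; exact hpos.ne')
  rw [← h3, ofReal_integral_eq_lintegral_ofReal hint (ae_of_all _ fun _ => (Real.exp_pos _).le)]

theorem lintegral_mehlerGaussian {T : ℝ} (hT : 0 < T) :
    ∫⁻ y : EuclideanSpace ℝ (Fin 3) × EuclideanSpace ℝ (Fin 3),
      ENNReal.ofReal (mehlerGaussian T y.1 y.2) = ENNReal.ofReal ((2 * π) ^ 3) := by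
  have hinner (x : EuclideanSpace ℝ (Fin 3)) :
      ∫⁻ y, ENNReal.ofReal (mehlerGaussian T x y) =
        ∫⁻ u, ENNReal.ofReal (Real.exp (-(1 / (4 * T)) * ‖u‖ ^ 2)) *
          ENNReal.ofReal (Real.exp (-T * ‖x - (1 / 2 : ℝ) • u‖ ^ 2)) := by
    rw [← lintegral_sub_left_eq_self _ x]
    refine lintegral_congr fun y => ?_
    rw [← ENNReal.ofReal_mul (Real.exp_pos _).le, ← Real.exp_add, mehlerGaussian]
    have h1 : x + (x - y) = (2 : ℝ) • (x - (1 / 2 : ℝ) • y) := by module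
    rw [h1, norm_smul, sub_sub_cancel, Real.norm_ofNat]
    congr 2
    ring
  rw [Measure.volume_eq_prod, lintegral_prod _ (by unfold mehlerGaussian; fun_prop)]
  simp_rw [hinner]
  rw [lintegral_lintegral_swap (by fun_prop)]
  have houter (u : EuclideanSpace ℝ (Fin 3)) :
      ∫⁻ x, ENNReal.ofReal (Real.exp (-(1 / (4 * T)) * ‖u‖ ^ 2)) *
          ENNReal.ofReal (Real.exp (-T * ‖x - (1 / 2 : ℝ) • u‖ ^ 2)) =
        ENNReal.ofReal (Real.exp (-(1 / (4 * T)) * ‖u‖ ^ 2)) *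
          ENNReal.ofReal ((π / T) ^ ((3 : ℝ) / 2)) := by
    rw [lintegral_const_mul' _ _ ENNReal.ofReal_ne_top,
      lintegral_sub_right_eq_self
        (fun x => ENNReal.ofReal (Real.exp (-T * ‖x‖ ^ 2))) ((1 / 2 : ℝ) • u),
      lintegral_exp_neg_mul_norm_sq hT]
  simp_rw [houter]
  rw [lintegral_mul_const' _ _ ENNReal.ofReal_ne_top, lintegral_exp_neg_mul_norm_sq (by positivity),
    ← ENNReal.ofReal_mul (by positivity), ← Real.mul_rpow (by positivity) (by positivity)]
  congr 1
  have h2 : π / (1 / (4 * T)) * (π / T) = (2 * π) ^ 2 := by field_simp; ring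
  rw [h2, ← Real.rpow_natCast, ← Real.rpow_mul (by positivity), ← Real.rpow_natCast]
  norm_num

theorem mehlerK_nonneg {t : ℝ} (ht : 0 < t) (x y : EuclideanSpace ℝ (Fin 3)) :
    0 ≤ mehlerK t x y := by
  have : 0 ≤ Real.sinh (2 * t) := Real.sinh_nonneg_iff.2 (by linarith)
  unfold mehlerK
  positivity

theorem tanh_pos_of_pos {t : ℝ} (ht : 0 < t) : 0 < Real.tanh t := by
  rw [Real.tanh_eq_sinh_div_cosh]
  exact div_pos (Real.sinh_pos_iff.2 ht) (Real.cosh_pos t)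

theorem mehlerK_le_rpow_mul {t : ℝ} (ht : 0 < t) (x y : EuclideanSpace ℝ (Fin 3)) :
    mehlerK t x y ≤ t ^ (-(3 : ℝ) / 2) * mehlerGaussian (Real.tanh t) x y := by
  refine mul_le_mul_of_nonneg_right ?_ (Real.exp_pos _).le
  refine Real.rpow_le_rpow_of_nonpos ht ?_ (by norm_num)
  have h1 : 2 * t ≤ Real.sinh (2 * t) := Real.self_le_sinh_iff.2 (by linarith)
  nlinarith [Real.pi_gt_three]

theorem mehlerGaussian_le_one {T : ℝ} (hT : 0 < T) (x y : EuclideanSpace ℝ (Fin 3)) :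
    mehlerGaussian T x y ≤ 1 := by
  rw [mehlerGaussian, Real.exp_le_one_iff]
  have h1 : 0 ≤ ‖x - y‖ ^ 2 / (4 * T) := by positivity
  have h2 : 0 ≤ T * ‖x + y‖ ^ 2 / 4 := by positivity
  rw [neg_div]
  linarith

theorem measurable_uncurry_mehlerK :
    Measurable fun z : (EuclideanSpace ℝ (Fin 3) × EuclideanSpace ℝ (Fin 3)) × ℝ =>
      mehlerK z.2 z.1.1 z.1.2 := by
  unfold mehlerK
  simp_rw [Real.tanh_eq_sinh_div_cosh]
  fun_prop

theorem lintegral_Ioi_rpow_neg_three_halves {d : ℝ} (hd : 0 < d) :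
    ∫⁻ s in Set.Ioi d, ENNReal.ofReal (s ^ (-(3 : ℝ) / 2)) =
      ENNReal.ofReal (2 * d ^ (-(1 : ℝ) / 2)) := by
  rw [← ofReal_integral_eq_lintegral_ofReal (integrableOn_Ioi_rpow_of_lt (by norm_num) hd)
    ((ae_restrict_mem measurableSet_Ioi).mono fun s hs => Real.rpow_nonneg (hd.trans hs).le _),
    integral_Ioi_rpow_of_lt (by norm_num) hd]
  congr 1
  norm_num
  ring

theorem abs_sub_add_le_add {t₁ t₂ : ℝ} (h₁ : 0 ≤ t₁) (h₂ : 0 ≤ t₂) (c : ℝ) :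
    |t₂ - t₁| + c ≤ t₁ + t₂ + c := by
  gcongr
  exact abs_le.2 ⟨by linarith, by linarith⟩

theorem covC_nonneg {t₁ t₂ : ℝ} (h₁ : 0 ≤ t₁) (h₂ : 0 ≤ t₂) (n : ℕ)
    (y₁ y₂ : EuclideanSpace ℝ (Fin 3)) : 0 ≤ covC n t₁ t₂ y₁ y₂ := by
  refine mul_nonneg (by norm_num) (intervalIntegral.integral_nonneg (abs_sub_add_le_add h₁ h₂ _) ?_)
  intro s hs
  have : (0 : ℝ) < 2 * (2 : ℝ) ^ (-(n : ℝ)) := by positivity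
  exact mehlerK_nonneg (by linarith [hs.1, abs_nonneg (t₂ - t₁)]) _ _

theorem ofReal_covC_le_lintegral {t₁ t₂ : ℝ} (h₁ : 0 ≤ t₁) (h₂ : 0 ≤ t₂) (n : ℕ)
    (y₁ y₂ : EuclideanSpace ℝ (Fin 3)) :
    ENNReal.ofReal (covC n t₁ t₂ y₁ y₂) ≤ ENNReal.ofReal (1 / 2) *
      ∫⁻ s in Set.Ioi |t₂ - t₁|, ENNReal.ofReal (mehlerK s y₁ y₂) := by
  have hε : (0 : ℝ) ≤ 2 * (2 : ℝ) ^ (-(n : ℝ)) := by positivity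
  rw [covC, ENNReal.ofReal_mul (by norm_num),
    intervalIntegral.integral_of_le (abs_sub_add_le_add h₁ h₂ _)]
  gcongr
  refine (ENNReal.ofReal_le_ofReal (le_abs_self _)).trans ?_
  rw [← Real.enorm_eq_ofReal_abs]
  refine (enorm_integral_le_lintegral_enorm _).trans ?_
  have hsub : Set.Ioc (|t₂ - t₁| + 2 * (2 : ℝ) ^ (-(n : ℝ)))
      (t₁ + t₂ + 2 * (2 : ℝ) ^ (-(n : ℝ))) ⊆ Set.Ioi |t₂ - t₁| :=
    fun s hs => lt_of_le_of_lt (by linarith) hs.1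
  refine (lintegral_mono_set hsub).trans (setLIntegral_mono' measurableSet_Ioi fun s hs => ?_)
  rw [Real.enorm_eq_ofReal (mehlerK_nonneg ((abs_nonneg _).trans_lt hs) _ _)]

theorem covC_le_rpow {t₁ t₂ : ℝ} (h₁ : 0 ≤ t₁) (h₂ : 0 ≤ t₂) (hne : t₁ ≠ t₂) (n : ℕ)
    (y₁ y₂ : EuclideanSpace ℝ (Fin 3)) :
    covC n t₁ t₂ y₁ y₂ ≤ |t₂ - t₁| ^ (-(1 : ℝ) / 2) := by
  have hd : 0 < |t₂ - t₁| := abs_pos.2 (sub_ne_zero.2 hne.symm)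
  rw [← ENNReal.ofReal_le_ofReal_iff (by positivity)]
  refine (ofReal_covC_le_lintegral h₁ h₂ n y₁ y₂).trans ?_
  have hmono : ∫⁻ s in Set.Ioi |t₂ - t₁|, ENNReal.ofReal (mehlerK s y₁ y₂) ≤
      ∫⁻ s in Set.Ioi |t₂ - t₁|, ENNReal.ofReal (s ^ (-(3 : ℝ) / 2)) := by
    refine setLIntegral_mono' measurableSet_Ioi fun s hs => ENNReal.ofReal_le_ofReal ?_
    have hs0 : 0 < s := hd.trans hs
    exact (mehlerK_le_rpow_mul hs0 _ _).trans (mul_le_of_le_one_right (by positivity)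
      (mehlerGaussian_le_one (tanh_pos_of_pos hs0) _ _))
  refine (mul_le_mul_right hmono _).trans_eq ?_
  rw [lintegral_Ioi_rpow_neg_three_halves hd, ← ENNReal.ofReal_mul (by norm_num)]
  congr 1
  ring

theorem lintegral_mehlerK_le {t : ℝ} (ht : 0 < t) :
    ∫⁻ y : EuclideanSpace ℝ (Fin 3) × EuclideanSpace ℝ (Fin 3),
      ENNReal.ofReal (mehlerK t y.1 y.2) ≤
        ENNReal.ofReal (t ^ (-(3 : ℝ) / 2)) * ENNReal.ofReal ((2 * π) ^ 3) := by
  rw [← lintegral_mehlerGaussian (tanh_pos_of_pos ht),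
    ← lintegral_const_mul' _ _ ENNReal.ofReal_ne_top]
  refine lintegral_mono fun y => ?_
  rw [← ENNReal.ofReal_mul (by positivity)]
  exact ENNReal.ofReal_le_ofReal (mehlerK_le_rpow_mul ht _ _)

theorem lintegral_covC_le {t₁ t₂ : ℝ} (h₁ : 0 ≤ t₁) (h₂ : 0 ≤ t₂) (hne : t₁ ≠ t₂) (n : ℕ) :
    ∫⁻ y : EuclideanSpace ℝ (Fin 3) × EuclideanSpace ℝ (Fin 3),
      ENNReal.ofReal (covC n t₁ t₂ y.1 y.2) ≤
        ENNReal.ofReal ((2 * π) ^ 3 * |t₂ - t₁| ^ (-(1 : ℝ) / 2)) := by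
  have hd : 0 < |t₂ - t₁| := abs_pos.2 (sub_ne_zero.2 hne.symm)
  have hswap : ∫⁻ y : EuclideanSpace ℝ (Fin 3) × EuclideanSpace ℝ (Fin 3),
      ∫⁻ s in Set.Ioi |t₂ - t₁|, ENNReal.ofReal (mehlerK s y.1 y.2) =
      ∫⁻ s in Set.Ioi |t₂ - t₁|, ∫⁻ y : EuclideanSpace ℝ (Fin 3) × EuclideanSpace ℝ (Fin 3),
        ENNReal.ofReal (mehlerK s y.1 y.2) :=
    lintegral_lintegral_swap measurable_uncurry_mehlerK.ennreal_ofReal.aemeasurable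
  have hmono : ∫⁻ s in Set.Ioi |t₂ - t₁|,
      ∫⁻ y : EuclideanSpace ℝ (Fin 3) × EuclideanSpace ℝ (Fin 3),
        ENNReal.ofReal (mehlerK s y.1 y.2) ≤
      ENNReal.ofReal (2 * |t₂ - t₁| ^ (-(1 : ℝ) / 2)) * ENNReal.ofReal ((2 * π) ^ 3) := by
    rw [← lintegral_Ioi_rpow_neg_three_halves hd, ← lintegral_mul_const' _ _ ENNReal.ofReal_ne_top]
    exact setLIntegral_mono' measurableSet_Ioi fun s hs => lintegral_mehlerK_le (hd.trans hs)
  have hcov : ∫⁻ y : EuclideanSpace ℝ (Fin 3) × EuclideanSpace ℝ (Fin 3),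
      ENNReal.ofReal (covC n t₁ t₂ y.1 y.2) ≤
      ∫⁻ y : EuclideanSpace ℝ (Fin 3) × EuclideanSpace ℝ (Fin 3), ENNReal.ofReal (1 / 2) *
        ∫⁻ s in Set.Ioi |t₂ - t₁|, ENNReal.ofReal (mehlerK s y.1 y.2) :=
    lintegral_mono fun y => ofReal_covC_le_lintegral h₁ h₂ n y.1 y.2
  refine hcov.trans ?_
  rw [lintegral_const_mul' _ _ ENNReal.ofReal_ne_top, hswap]
  refine (mul_le_mul_right hmono _).trans_eq ?_
  rw [← ENNReal.ofReal_mul (by positivity), ← ENNReal.ofReal_mul (by norm_num)]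
  congr 1
  ring

theorem integral_covC_rpow_le {p : ℝ} (hp : 1 ≤ p) {t₁ t₂ : ℝ} (h₁ : 0 ≤ t₁) (h₂ : 0 ≤ t₂)
    (hne : t₁ ≠ t₂) (n : ℕ) :
    ∫ y : EuclideanSpace ℝ (Fin 3) × EuclideanSpace ℝ (Fin 3), covC n t₁ t₂ y.1 y.2 ^ p ≤
      (2 * π) ^ 3 * (|t₂ - t₁| ^ (-(1 : ℝ) / 2)) ^ p := by
  have hd : 0 < |t₂ - t₁| := abs_pos.2 (sub_ne_zero.2 hne.symm)
  set D := |t₂ - t₁| ^ (-(1 : ℝ) / 2) with hD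
  have hD0 : 0 < D := by positivity
  have hsplit {c : ℝ} (hc : 0 ≤ c) : c ^ p = c ^ (p - 1) * c := by
    rw [← Real.rpow_add_one' hc (by linarith), sub_add_cancel]
  refine (Real.le_norm_self _).trans ((norm_integral_le_lintegral_norm _).trans ?_)
  refine ENNReal.toReal_le_of_le_ofReal (by positivity) ?_
  have hmono (y : EuclideanSpace ℝ (Fin 3) × EuclideanSpace ℝ (Fin 3)) :
      ENNReal.ofReal ‖covC n t₁ t₂ y.1 y.2 ^ p‖ ≤
        ENNReal.ofReal (D ^ (p - 1)) * ENNReal.ofReal (covC n t₁ t₂ y.1 y.2) := by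
    have h0 := covC_nonneg h₁ h₂ n y.1 y.2
    rw [← ENNReal.ofReal_mul (by positivity), Real.norm_of_nonneg (Real.rpow_nonneg h0 _),
      hsplit h0]
    refine ENNReal.ofReal_le_ofReal (mul_le_mul_of_nonneg_right ?_ h0)
    exact Real.rpow_le_rpow h0 (covC_le_rpow h₁ h₂ hne n _ _) (by linarith)
  refine (lintegral_mono hmono).trans ?_
  rw [lintegral_const_mul' _ _ ENNReal.ofReal_ne_top]
  refine (mul_le_mul_right (lintegral_covC_le h₁ h₂ hne n) _).trans_eq ?_
  rw [← ENNReal.ofReal_mul (by positivity), hsplit hD0.le]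
  congr 1
  ring

/-- uniform-in-`n` `Lᵖ` (`1 ≤ p < ∞`) and `L^∞` bounds on the regularized
covariance: `‖𝒞⁽ⁿ⁾_{t₁,t₂}‖_{Lᵖ(ℝ⁶)} ≲ |t₂-t₁|^{-1/2}` and
`sup 𝒞⁽ⁿ⁾_{t₁,t₂} ≲ |t₂-t₁|^{-1/2}`. -/
theorem covC_Lp_bound :
    (∀ p : ℝ, 1 ≤ p →
      ∃ C : ℝ, 0 < C ∧
        ∀ t₁ t₂ : ℝ, 0 ≤ t₁ → 0 ≤ t₂ → t₁ ≠ t₂ → ∀ n : ℕ, 1 ≤ n →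
          (∫ y : EuclideanSpace ℝ (Fin 3) × EuclideanSpace ℝ (Fin 3),
              covC n t₁ t₂ y.1 y.2 ^ p) ^ (1 / p) ≤ C * |t₂ - t₁| ^ (-(1 : ℝ) / 2)) ∧
    (∃ C : ℝ, 0 < C ∧
        ∀ t₁ t₂ : ℝ, 0 ≤ t₁ → 0 ≤ t₂ → t₁ ≠ t₂ → ∀ n : ℕ, 1 ≤ n →
          ∀ y₁ y₂ : EuclideanSpace ℝ (Fin 3),
            covC n t₁ t₂ y₁ y₂ ≤ C * |t₂ - t₁| ^ (-(1 : ℝ) / 2)) := by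
  refine ⟨fun p hp => ⟨(2 * π) ^ 3, by positivity, fun t₁ t₂ h₁ h₂ hne n _ => ?_⟩,
    1, one_pos, fun t₁ t₂ h₁ h₂ hne n _ y₁ y₂ => ?_⟩
  · have hp0 : 0 < p := by linarith
    have hM : (1 : ℝ) ≤ (2 * π) ^ 3 := one_le_pow₀ (by linarith [Real.pi_gt_three])
    rw [one_div, Real.rpow_inv_le_iff_of_pos
      (integral_nonneg fun y => Real.rpow_nonneg (covC_nonneg h₁ h₂ n _ _) _)
      (by positivity) hp0, Real.mul_rpow (by positivity) (by positivity)]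
    refine (integral_covC_rpow_le hp h₁ h₂ hne n).trans ?_
    gcongr
    exact Real.self_le_rpow_of_one_le hM hp
  · rw [one_mul]
    exact covC_le_rpow h₁ h₂ hne n y₁ y₂

end
end

section
/- Let T > 0 and 0 < η < 1/2. There exists a constant C = C(T, η) > 0 such that for all times 0 ≤ t₁ < t₂ ≤ T, 0 < s₁ < t₁, 0 < s₂ < t₂ with t₁, t₂, s₁, s₂ pairwise distinct, all integers n ≥ 1 and all w₁, w₂ ∈ ℝ³, one has |𝒞⁽ⁿ⁾_{s₁,s₂}(w₁,w₂) − 𝒞⁽ⁿ⁾_{s₁,t₂}(w₁,w₂) − 𝒞⁽ⁿ⁾_{t₁,s₂}(w₁,w₂) + 𝒞⁽ⁿ⁾_{t₁,t₂}(w₁,w₂)| ≤ C · |t₁−s₁|^η · |t₂−s₂|^η · (𝒬^{(1/2)}_{t,s})^{1−2η} · (𝒬^{(3/2)}_{t,s})^{2η}. -/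
open MeasureTheory Real

noncomputable section

/-- The quantity `𝒬^{(ν)}_{t,s}`. -/
def Qnu (ν t₁ t₂ s₁ s₂ : ℝ) : ℝ :=
  |s₁ - s₂| ^ (-ν) + |t₂ - s₁| ^ (-ν) + |t₁ - s₂| ^ (-ν) + |t₁ - t₂| ^ (-ν)

/-- The kernel is continuous in time away from the initial time. -/
lemma continuousOn_mehlerK (x y : EuclideanSpace ℝ (Fin 3)) :
    ContinuousOn (fun σ => mehlerK σ x y) (Set.Ioi 0) := by
  have htanh : Continuous Real.tanh := by
    rw [show Real.tanh = fun x => Real.sinh x / Real.cosh x from funext Real.tanh_eq_sinh_div_cosh]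
    exact Real.continuous_sinh.div Real.continuous_cosh fun x => (Real.cosh_pos x).ne'
  intro σ hσ
  have hσ : 0 < σ := hσ
  have hsinh : 0 < Real.sinh (2 * σ) := Real.sinh_pos_iff.2 (by linarith)
  have htσ : Real.tanh σ ≠ 0 := by
    rw [Real.tanh_eq_sinh_div_cosh]
    exact (div_pos (Real.sinh_pos_iff.2 hσ) (Real.cosh_pos σ)).ne'
  apply ContinuousAt.continuousWithinAt
  unfold mehlerK
  refine ContinuousAt.mul (ContinuousAt.rpow_const ?_ (Or.inl (by positivity))) ?_
  · exact (continuous_const.mul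
      (Real.continuous_sinh.comp (continuous_const.mul continuous_id))).continuousAt
  · refine ContinuousAt.rexp (ContinuousAt.sub ?_ ?_)
    · exact continuousAt_const.div (continuousAt_const.mul htanh.continuousAt) (by positivity)
    · exact (htanh.continuousAt.mul continuousAt_const).div_const _

lemma intervalIntegrable_mehlerK {a b : ℝ} (ha : 0 < a) (hb : 0 < b)
    (x y : EuclideanSpace ℝ (Fin 3)) :
    IntervalIntegrable (fun σ => mehlerK σ x y) volume a b :=
  ((continuousOn_mehlerK x y).mono fun _ hσ =>
    (lt_min ha hb).trans_le hσ.1).intervalIntegrable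

lemma abs_mehlerK_le {σ : ℝ} (hσ : 0 < σ) (x y : EuclideanSpace ℝ (Fin 3)) :
    |mehlerK σ x y| ≤ σ ^ (-(3 / 2) : ℝ) := by
  have hsinh : 2 * σ < Real.sinh (2 * σ) := Real.self_lt_sinh_iff.2 (by linarith)
  have htanh : 0 < Real.tanh σ := by
    rw [Real.tanh_eq_sinh_div_cosh]
    exact div_pos (Real.sinh_pos_iff.2 hσ) (Real.cosh_pos σ)
  have hbase : σ ≤ 2 * π * Real.sinh (2 * σ) := by
    nlinarith [Real.pi_gt_three]
  have hexp : Real.exp (-‖x - y‖ ^ 2 / (4 * Real.tanh σ) - Real.tanh σ * ‖x + y‖ ^ 2 / 4) ≤ 1 := by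
    rw [Real.exp_le_one_iff, neg_div]
    have h₁ : 0 ≤ ‖x - y‖ ^ 2 / (4 * Real.tanh σ) := by positivity
    have h₂ : 0 ≤ Real.tanh σ * ‖x + y‖ ^ 2 / 4 := by positivity
    linarith
  have hpow : (2 * π * Real.sinh (2 * σ)) ^ (-(3 : ℝ) / 2) ≤ σ ^ (-(3 / 2) : ℝ) := by
    rw [neg_div]
    exact Real.rpow_le_rpow_of_nonpos hσ hbase (by norm_num)
  have hpos : 0 < 2 * π * Real.sinh (2 * σ) := hσ.trans_le hbase
  unfold mehlerK
  rw [abs_of_nonneg (by positivity)]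
  calc _ ≤ (2 * π * Real.sinh (2 * σ)) ^ (-(3 : ℝ) / 2) * 1 := by gcongr
    _ ≤ _ := by rwa [mul_one]

/-- Lipschitz bound for the time primitive of the kernel. -/
lemma abs_integral_mehlerK_le_mul {m a b : ℝ} (hm : 0 < m) (ha : m ≤ a) (hb : m ≤ b)
    (x y : EuclideanSpace ℝ (Fin 3)) :
    |∫ σ in a..b, mehlerK σ x y| ≤ m ^ (-(3 / 2) : ℝ) * |b - a| := by
  rw [← Real.norm_eq_abs]
  refine intervalIntegral.norm_integral_le_of_norm_le_const fun σ hσ => ?_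
  have hmσ : m ≤ σ := (le_min ha hb).trans hσ.1.le
  exact (abs_mehlerK_le (hm.trans_le hmσ) x y).trans
    (Real.rpow_le_rpow_of_nonpos hm hmσ (by norm_num))

/-- Uniform bound for the time primitive of the kernel. -/
lemma abs_integral_mehlerK_le {m a b : ℝ} (hm : 0 < m) (ha : m ≤ a) (hab : a ≤ b)
    (x y : EuclideanSpace ℝ (Fin 3)) :
    |∫ σ in a..b, mehlerK σ x y| ≤ 2 * m ^ (-(1 / 2) : ℝ) := by
  have ha0 : 0 < a := hm.trans_le ha
  have hb0 : 0 < b := ha0.trans_le hab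
  have h0 : (0 : ℝ) ∉ Set.uIcc a b := fun h => (lt_min ha0 hb0).not_ge h.1
  have hle : ‖∫ σ in a..b, mehlerK σ x y‖ ≤ ∫ σ in a..b, σ ^ (-(3 / 2) : ℝ) :=
    intervalIntegral.norm_integral_le_of_norm_le hab
      (Filter.Eventually.of_forall fun σ hσ => abs_mehlerK_le (ha0.trans hσ.1) x y)
      (intervalIntegral.intervalIntegrable_rpow (Or.inr h0))
  rw [integral_rpow (Or.inr ⟨by norm_num, h0⟩),
    show (-(3 / 2) + 1 : ℝ) = -(1 / 2) by norm_num] at hle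
  have hma : a ^ (-(1 / 2) : ℝ) ≤ m ^ (-(1 / 2) : ℝ) :=
    Real.rpow_le_rpow_of_nonpos hm ha (by norm_num)
  have hb1 : 0 ≤ b ^ (-(1 / 2) : ℝ) := by positivity
  rw [Real.norm_eq_abs] at hle
  refine hle.trans ?_
  linarith

lemma covC_comm (n : ℕ) (p q : ℝ) (x y : EuclideanSpace ℝ (Fin 3)) :
    covC n p q x y = covC n q p x y := by
  unfold covC
  rw [abs_sub_comm, add_comm p q]

lemma abs_covC_le (n : ℕ) {m p q : ℝ} (hm : 0 < m) (hp : 0 ≤ p) (hq : 0 ≤ q)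
    (h : m ≤ |q - p|) (x y : EuclideanSpace ℝ (Fin 3)) :
    |covC n p q x y| ≤ m ^ (-(1 / 2) : ℝ) := by
  have hε : 0 < (2 : ℝ) ^ (-(n : ℝ)) := by positivity
  have hsum : |q - p| ≤ p + q := abs_le.2 ⟨by linarith, by linarith⟩
  have hint := abs_integral_mehlerK_le hm
    (a := |q - p| + 2 * (2 : ℝ) ^ (-(n : ℝ))) (b := p + q + 2 * (2 : ℝ) ^ (-(n : ℝ)))
    (by linarith) (by linarith) x y
  unfold covC
  rw [abs_mul, abs_of_pos (by norm_num : (0 : ℝ) < 1 / 2)]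
  linarith

/-- The covariance is Lipschitz in its first time away from the diagonal. -/
lemma abs_covC_sub_covC_le (n : ℕ) {m p p' q : ℝ} (hm : 0 < m) (hp : 0 ≤ p) (hp' : 0 ≤ p')
    (hq : 0 ≤ q) (h : m ≤ |q - p|) (h' : m ≤ |q - p'|) (x y : EuclideanSpace ℝ (Fin 3)) :
    |covC n p q x y - covC n p' q x y| ≤ |p' - p| * m ^ (-(3 / 2) : ℝ) := by
  have hε : 0 < 2 * (2 : ℝ) ^ (-(n : ℝ)) := by positivity
  have hsum : |q - p| ≤ p + q := abs_le.2 ⟨by linarith, by linarith⟩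
  have hsum' : |q - p'| ≤ p' + q := abs_le.2 ⟨by linarith, by linarith⟩
  unfold covC
  generalize 2 * (2 : ℝ) ^ (-(n : ℝ)) = ε at *
  have hdiff : ∫ σ in (|q - p| + ε)..(p + q + ε), mehlerK σ x y =
      (∫ σ in (|q - p| + ε)..(|q - p'| + ε), mehlerK σ x y) +
      (∫ σ in (|q - p'| + ε)..(p' + q + ε), mehlerK σ x y) +
      ∫ σ in (p' + q + ε)..(p + q + ε), mehlerK σ x y := by
    rw [intervalIntegral.integral_add_adjacent_intervals,
      intervalIntegral.integral_add_adjacent_intervals] <;>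
    exact intervalIntegrable_mehlerK (by linarith) (by linarith) x y
  have hlower := abs_integral_mehlerK_le_mul hm
    (a := |q - p| + ε) (b := |q - p'| + ε) (by linarith) (by linarith) x y
  have hupper := abs_integral_mehlerK_le_mul hm
    (a := p' + q + ε) (b := p + q + ε) (by linarith) (by linarith) x y
  have hdist : |(|q - p'| + ε) - (|q - p| + ε)| ≤ |p' - p| := by
    have := abs_abs_sub_abs_le_abs_sub (q - p') (q - p)
    rw [show q - p' - (q - p) = -(p' - p) by ring, abs_neg] at this
    simpa using this
  have hdist' : |p + q + ε - (p' + q + ε)| = |p' - p| := by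
    rw [abs_sub_comm p' p]
    congr 1
    ring
  rw [hdist'] at hupper
  have hlower' := hlower.trans (mul_le_mul_of_nonneg_left hdist (by positivity))
  rw [hdiff]
  rw [abs_le] at *
  constructor <;> linarith [hlower'.1, hlower'.2, hupper.1, hupper.2]

/-- Some time gap controls all four, and its powers are controlled by `Qnu`. -/
lemma exists_gap_le_Qnu {t₁ t₂ s₁ s₂ : ℝ} (h₁ : s₁ ≠ s₂) (h₂ : t₂ ≠ s₁) (h₃ : t₁ ≠ s₂)
    (h₄ : t₁ ≠ t₂) :
    ∃ m : ℝ, 0 < m ∧ m ≤ |s₁ - s₂| ∧ m ≤ |t₂ - s₁| ∧ m ≤ |t₁ - s₂| ∧ m ≤ |t₁ - t₂| ∧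
      ∀ ν, m ^ (-ν) ≤ Qnu ν t₁ t₂ s₁ s₂ := by
  have p₁ := abs_pos.2 (sub_ne_zero.2 h₁)
  have p₂ := abs_pos.2 (sub_ne_zero.2 h₂)
  have p₃ := abs_pos.2 (sub_ne_zero.2 h₃)
  have p₄ := abs_pos.2 (sub_ne_zero.2 h₄)
  unfold Qnu
  generalize |s₁ - s₂| = a, |t₂ - s₁| = b, |t₁ - s₂| = c, |t₁ - t₂| = d at *
  refine ⟨min (min a b) (min c d), by positivity, by simp, by simp, by simp, by simp, fun ν => ?_⟩
  have q₁ : 0 < a ^ (-ν) := by positivity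
  have q₂ : 0 < b ^ (-ν) := by positivity
  have q₃ : 0 < c ^ (-ν) := by positivity
  have q₄ : 0 < d ^ (-ν) := by positivity
  rcases min_choice (min a b) (min c d) with h | h <;> rw [h]
  · rcases min_choice a b with h | h <;> rw [h] <;> linarith
  · rcases min_choice c d with h | h <;> rw [h] <;> linarith

/-- Interpolation between a uniform bound and two Lipschitz bounds. -/
lemma le_interpolation {D c A B h k η : ℝ} (hD : 0 ≤ D) (hc : 0 ≤ c) (hA : 0 ≤ A) (hB : 0 ≤ B)
    (hh : 0 ≤ h) (hk : 0 ≤ k) (hη0 : 0 < η) (hη : η < 1 / 2)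
    (hDA : D ≤ c * A) (hDh : D ≤ c * (h * B)) (hDk : D ≤ c * (k * B)) :
    D ≤ c * h ^ η * k ^ η * A ^ (1 - 2 * η) * B ^ (2 * η) := by
  have split_rpow {z : ℝ} (hz : 0 ≤ z) : z ^ (1 - 2 * η) * z ^ η * z ^ η = z := by
    rw [← Real.rpow_add_of_nonneg hz (by linarith) hη0.le,
      ← Real.rpow_add_of_nonneg hz (by linarith) hη0.le]
    ring_nf
    exact Real.rpow_one z
  have hB2 : B ^ (2 * η) = B ^ η * B ^ η := by
    rw [← Real.rpow_add_of_nonneg hB hη0.le hη0.le, two_mul]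
  calc D = D ^ (1 - 2 * η) * D ^ η * D ^ η := (split_rpow hD).symm
    _ ≤ (c * A) ^ (1 - 2 * η) * (c * (h * B)) ^ η * (c * (k * B)) ^ η := by
      have : 0 ≤ 1 - 2 * η := by linarith
      gcongr
    _ = (c ^ (1 - 2 * η) * c ^ η * c ^ η) * h ^ η * k ^ η * A ^ (1 - 2 * η) * B ^ (2 * η) := by
      rw [Real.mul_rpow hc hA, Real.mul_rpow hc (by positivity), Real.mul_rpow hc (by positivity),
        Real.mul_rpow hh hB, Real.mul_rpow hk hB, hB2]
      ring
    _ = _ := by rw [split_rpow hc]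

/-- the rectangular increment of the regularized covariance in the time
variables satisfies a uniform-in-`n` Hölder-type bound. -/
theorem covC_time_rectangular_increment_bound (T : ℝ) (hT : 0 < T)
    (η : ℝ) (hη0 : 0 < η) (hη : η < 1 / 2) :
    ∃ C : ℝ, 0 < C ∧
      ∀ t₁ t₂ s₁ s₂ : ℝ,
        0 ≤ t₁ → t₁ < t₂ → t₂ ≤ T → 0 < s₁ → s₁ < t₁ → 0 < s₂ → s₂ < t₂ →
        t₁ ≠ s₂ → s₁ ≠ s₂ →
        ∀ n : ℕ, 1 ≤ n → ∀ w₁ w₂ : EuclideanSpace ℝ (Fin 3),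
          |covC n s₁ s₂ w₁ w₂ - covC n s₁ t₂ w₁ w₂ - covC n t₁ s₂ w₁ w₂ + covC n t₁ t₂ w₁ w₂| ≤
            C * |t₁ - s₁| ^ η * |t₂ - s₂| ^ η *
              Qnu (1 / 2) t₁ t₂ s₁ s₂ ^ (1 - 2 * η) * Qnu (3 / 2) t₁ t₂ s₁ s₂ ^ (2 * η) := by
  refine ⟨4, by norm_num, ?_⟩
  intro t₁ t₂ s₁ s₂ ht₁ ht _ hs₁ hst₁ hs₂ hst₂ hts hss n _ w₁ w₂
  obtain ⟨m, hm, m₁, m₂, m₃, m₄, hQ⟩ :=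
    exists_gap_le_Qnu hss (hst₁.trans ht).ne' hts ht.ne
  have hQ₁ := hQ (1 / 2)
  have hQ₃ := hQ (3 / 2)
  have hA : 0 ≤ Qnu (1 / 2) t₁ t₂ s₁ s₂ := le_trans (by positivity) hQ₁
  have hB : 0 ≤ Qnu (3 / 2) t₁ t₂ s₁ s₂ := le_trans (by positivity) hQ₃
  have ht₂ : 0 ≤ t₂ := ht₁.trans ht.le
  have m₁' := abs_sub_comm s₁ s₂ ▸ m₁
  have m₂' := abs_sub_comm t₂ s₁ ▸ m₂
  have m₃' := abs_sub_comm t₁ s₂ ▸ m₃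
  have m₄' := abs_sub_comm t₁ t₂ ▸ m₄
  refine le_interpolation (abs_nonneg _) (by norm_num) hA hB (abs_nonneg _) (abs_nonneg _)
    hη0 hη ?_ ?_ ?_
  · have b₁ := abs_le.1 (abs_covC_le n hm hs₁.le hs₂.le m₁' w₁ w₂)
    have b₂ := abs_le.1 (abs_covC_le n hm hs₁.le ht₂ m₂ w₁ w₂)
    have b₃ := abs_le.1 (abs_covC_le n hm ht₁ hs₂.le m₃' w₁ w₂)
    have b₄ := abs_le.1 (abs_covC_le n hm ht₁ ht₂ m₄' w₁ w₂)
    rw [abs_le]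
    constructor <;> linarith [b₁.1, b₁.2, b₂.1, b₂.2, b₃.1, b₃.2, b₄.1, b₄.2]
  · have b₁ := abs_le.1 (abs_covC_sub_covC_le n hm hs₁.le ht₁ hs₂.le m₁' m₃' w₁ w₂)
    have b₂ := abs_le.1 (abs_covC_sub_covC_le n hm hs₁.le ht₁ ht₂ m₂ m₄' w₁ w₂)
    have hmul := mul_le_mul_of_nonneg_left hQ₃ (abs_nonneg (t₁ - s₁))
    have hnn := mul_nonneg (abs_nonneg (t₁ - s₁)) hB
    rw [abs_le]
    constructor <;> linarith [b₁.1, b₁.2, b₂.1, b₂.2]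
  · have b₁ := abs_le.1 (abs_covC_sub_covC_le n hm hs₂.le ht₂ hs₁.le m₁ m₂' w₁ w₂)
    have b₂ := abs_le.1 (abs_covC_sub_covC_le n hm hs₂.le ht₂ ht₁ m₃ m₄ w₁ w₂)
    have hmul := mul_le_mul_of_nonneg_left hQ₃ (abs_nonneg (t₂ - s₂))
    have hnn := mul_nonneg (abs_nonneg (t₂ - s₂)) hB
    rw [covC_comm n s₁ s₂, covC_comm n s₁ t₂, covC_comm n t₁ s₂, covC_comm n t₁ t₂, abs_le]
    constructor <;> linarith [b₁.1, b₁.2, b₂.1, b₂.2]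

end
end
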